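/- Let α_1 > 0, β_1 ∈ ℝ with |β_1| < α_1, α_2 > 0, β_2 ∈ ℝ with |β_2| < α_2, let μ > 0, G > 0, Γ_2 > 0, y > 0 be real, and let t < T. With c(y,u) := y·G·e^{μu} − iβ_1 and η(w) := (1/μ)·[ √(α_1² + w²) − iβ_1·arcsinh(w/α_1) − √(α_1² − β_1²)·log( 2α_1²·(α_1² − iβ_1 w + √(α_1² − β_1²)·√(α_1² + w²)) / ((w + iβ_1)·(α_1² − β_1²)^{3/2}) ) ] (principal branches, arcsinh(z) := log(z + √(1+z²))), the following identity holds: ∫_t^T [ √(α_1² − β_1²) − √(α_1² − (β_1 + i·y·G·e^{μu})²) − i·y·G·e^{μu}·β_1/√(α_1² − β_1²) ] du + (T − t)·[ √(α_2² − β_2²) − √(α_2² − (β_2 + i·y·Γ_2)²) − i·y·Γ_2·β_2/√(α_2² − β_2²) ] = (T − t)·{ √(α_1² − β_1²) + √(α_2² − β_2²) − i·y·( G·β_1·(e^{μT} − e^{μt}) / (μ·√(α_1² − β_1²)·(T − t)) + Γ_2·β_2/√(α_2² − β_2²) ) − (η(c(y,T)) − η(c(y,t)))/(T − t) − √(α_2²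 − (β_2 + i·y·Γ_2)²) }. -/

import Mathlib

open MeasureTheory

lemma half_cpow_re_pos {z : ℂ} (hz : 0 < z.re) : 0 < (z ^ (1 / 2 : ℂ)).re := by
  have hne : z ≠ 0 := by rintro rfl; simp at hz
  rw [Complex.cpow_def_of_ne_zero hne, Complex.exp_re]
  have h := Complex.abs_arg_lt_pi_div_two_iff.2 (Or.inl hz)
  have h2 : (Complex.log z * (1 / 2 : ℂ)).im = z.arg / 2 := by
    have : Complex.log z * (1 / 2 : ℂ) = ((1 / 2 : ℝ) : ℂ) * Complex.log z := by
      push_cast; ring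
    rw [this, Complex.im_ofReal_mul, Complex.log_im]; ring
  rw [h2]
  rw [abs_lt] at h
  exact mul_pos (Real.exp_pos _) (Real.cos_pos_of_mem_Ioo ⟨by linarith [Real.pi_pos], by linarith [Real.pi_pos]⟩)

lemma half_cpow_sq (z : ℂ) : (z ^ (1 / 2 : ℂ)) ^ 2 = z := by
  simp

lemma half_cpow_deriv {f : ℂ → ℂ} {f' w : ℂ} (hf : HasDerivAt f f' w) (h : 0 < (f w).re) :
    HasDerivAt (fun w => (f w) ^ (1 / 2 : ℂ)) (f' / (2 * (f w) ^ (1 / 2 : ℂ))) w := by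
  have hne : f w ≠ 0 := by intro h0; simp [h0] at h
  have hS : (f w) ^ (1 / 2 : ℂ) ≠ 0 := by
    intro h0; have := half_cpow_re_pos h; rw [h0] at this; simp at this
  have h1 := hf.cpow_const (c := (1 / 2 : ℂ)) (Or.inl h)
  convert h1 using 1
  rw [Complex.cpow_sub _ _ hne, Complex.cpow_one]
  have h2 := half_cpow_sq (f w)
  generalize (f w) ^ (1 / 2 : ℂ) = S at *
  rw [← h2]
  field_simp

lemma eta_deriv (α β k D x : ℝ) (hα : 0 < α) (hk : 0 < k) (hD : 0 < D) (hx : 0 < x)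
    (hk2 : k ^ 2 = α ^ 2 - β ^ 2) (w : ℂ) (hw : w = (x : ℂ) - Complex.I * β) :
    HasDerivAt (fun w : ℂ => (((α : ℂ) ^ 2 + w ^ 2) ^ (1 / 2 : ℂ)
        - Complex.I * (β : ℂ) *
            Complex.log (w / (α : ℂ) + (1 + (w / (α : ℂ)) ^ 2) ^ (1 / 2 : ℂ))
        - (k : ℂ) *
            Complex.log (2 * (α : ℂ) ^ 2 *
              ((α : ℂ) ^ 2 - Complex.I * (β : ℂ) * w
                + (k : ℂ) * ((α : ℂ) ^ 2 + w ^ 2) ^ (1 / 2 : ℂ)) /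
              ((w + Complex.I * (β : ℂ)) * (D : ℂ)))))
      (((α : ℂ) ^ 2 + w ^ 2) ^ (1 / 2 : ℂ) / x) w := by
  have hαC : (α : ℂ) ≠ 0 := by exact_mod_cast hα.ne'
  have hxC : (x : ℂ) ≠ 0 := by exact_mod_cast hx.ne'
  have hDC : (D : ℂ) ≠ 0 := by exact_mod_cast hD.ne'
  have hwx : w + Complex.I * β = x := by rw [hw]; ring
  have hre : ((α : ℂ) ^ 2 + w ^ 2).re = k ^ 2 + x ^ 2 := by
    rw [hw, hk2]; simp [pow_two]; ring
  have hpos : 0 < ((α : ℂ) ^ 2 + w ^ 2).re := by rw [hre]; positivity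
  have hz : (1 + (w / (α : ℂ)) ^ 2) = ((1 / α ^ 2 : ℝ) : ℂ) * ((α : ℂ) ^ 2 + w ^ 2) := by
    push_cast; field_simp
  have hpos1 : 0 < (1 + (w / (α : ℂ)) ^ 2).re := by
    rw [hz, Complex.re_ofReal_mul]; positivity
  have hR : (1 + (w / (α : ℂ)) ^ 2) ^ (1 / 2 : ℂ) = ((α : ℂ) ^ 2 + w ^ 2) ^ (1 / 2 : ℂ) / α := by
    have h1 := half_cpow_sq (1 + (w / (α : ℂ)) ^ 2)
    have h2 := half_cpow_sq ((α : ℂ) ^ 2 + w ^ 2)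
    have p1 := half_cpow_re_pos hpos1
    have p2 := half_cpow_re_pos hpos
    generalize (1 + (w / (α : ℂ)) ^ 2) ^ (1 / 2 : ℂ) = R at *
    generalize ((α : ℂ) ^ 2 + w ^ 2) ^ (1 / 2 : ℂ) = S at *
    have : (R - S / α) * (R + S / α) = 0 := by
      have : (R - S / α) * (R + S / α) = R ^ 2 - S ^ 2 / α ^ 2 := by ring
      rw [this, h1, h2]; field_simp; ring
    rcases mul_eq_zero.1 this with h | h
    · exact sub_eq_zero.1 h
    · exfalso
      have := congrArg Complex.re h
      rw [Complex.add_re, Complex.div_ofReal_re] at this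
      have : 0 < S.re / α := by positivity
      simp at *; linarith
  have hSpos := half_cpow_re_pos hpos
  have hS2 := half_cpow_sq ((α : ℂ) ^ 2 + w ^ 2)
  have hid := hasDerivAt_id' w
  have dS := half_cpow_deriv (((hid.pow 2).const_add ((α : ℂ) ^ 2))) hpos
  have dR := half_cpow_deriv ((((hid.div_const (α : ℂ)).pow 2).const_add 1)) hpos1
  have dA := ((hid.div_const (α : ℂ)).add dR).clog (by
    left
    simp only [Pi.add_apply, Complex.add_re, Complex.div_ofReal_re]
    have : 0 < w.re := by rw [hw]; simpa using hx
    have := half_cpow_re_pos hpos1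
    positivity)
  have dN := ((((hid.const_mul (Complex.I * (β : ℂ))).const_sub ((α : ℂ) ^ 2)).add (dS.const_mul (k : ℂ))).const_mul (2 * (α : ℂ) ^ 2)).div ((hid.add_const (Complex.I * (β : ℂ))).mul_const (D : ℂ)) (by rw [hwx]; exact mul_ne_zero hxC hDC)
  have hNpos : 0 < ((α : ℂ) ^ 2 - Complex.I * (β : ℂ) * w
                + (k : ℂ) * ((α : ℂ) ^ 2 + w ^ 2) ^ (1 / 2 : ℂ)).re := by
    rw [Complex.add_re, Complex.re_ofReal_mul]
    have : ((α : ℂ) ^ 2 - Complex.I * (β : ℂ) * w).re = k ^ 2 := by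
      rw [hw, hk2]; simp [pow_two]
    rw [this]; positivity
  have dL := dN.clog (by
    left
    simp only [Pi.div_apply, Pi.add_apply, hwx]
    rw [show ∀ N : ℂ, 2 * (α : ℂ) ^ 2 * N / ((x : ℂ) * D) = ((2 * α ^ 2 / (x * D) : ℝ) : ℂ) * N by
      intro N; push_cast; ring, Complex.re_ofReal_mul]
    positivity)
  have dF := (dS.sub (dA.const_mul (Complex.I * (β : ℂ)))).sub (dL.const_mul (k : ℂ))
  refine HasDerivAt.congr_deriv (f' := _) dF ?_
  simp only [Pi.div_apply, Pi.add_apply, Pi.pow_apply, hwx, hR]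
  have hN0 : ((α : ℂ) ^ 2 - Complex.I * (β : ℂ) * w
                + (k : ℂ) * ((α : ℂ) ^ 2 + w ^ 2) ^ (1 / 2 : ℂ)) ≠ 0 := by
    intro h; rw [h] at hNpos; simp at hNpos
  have hS0 : ((α : ℂ) ^ 2 + w ^ 2) ^ (1 / 2 : ℂ) ≠ 0 := by
    intro h; rw [h] at hSpos; simp at hSpos
  have hA0 : w + ((α : ℂ) ^ 2 + w ^ 2) ^ (1 / 2 : ℂ) ≠ 0 := by
    intro h
    have := congrArg Complex.re h
    rw [Complex.add_re, hw] at this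
    rw [hw] at hSpos
    simp at this hSpos; linarith
  have hk2C : (k : ℂ) ^ 2 = (α : ℂ) ^ 2 - (β : ℂ) ^ 2 := by exact_mod_cast hk2
  have hI := Complex.I_sq
  generalize ((α : ℂ) ^ 2 + w ^ 2) ^ (1 / 2 : ℂ) = S at *
  have eA : (1 / (α : ℂ) + (((2 : ℕ) : ℂ) * (w / α) ^ (2 - 1) * (1 / (α : ℂ))) / (2 * (S / α))) / (w / α + S / α) = 1 / S := by
    norm_num
    field_simp
    ring
  have eL : (2 * (α : ℂ) ^ 2 * (-(Complex.I * β) + k * (w / S)) * (x * D) - 2 * (α : ℂ) ^ 2 * ((α : ℂ) ^ 2 - Complex.I * β * w + k * S) * D) / (x * D) ^ 2 / (2 * (α : ℂ) ^ 2 * ((α : ℂ) ^ 2 - Complex.I * β * w + k * S) / (x * D)) = - k / (x * S) := by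
    have h1 : (-(Complex.I * β) + k * (w / S)) * x
        - ((α : ℂ) ^ 2 - Complex.I * β * w + k * S) = - k / S * ((α : ℂ) ^ 2 - Complex.I * β * w + k * S) := by
      rw [← hwx]
      field_simp
      linear_combination (-(β : ℂ) ^ 2 * S) * hI + S * hk2C - k * hS2
    have h2 : 2 * (α : ℂ) ^ 2 * (-(Complex.I * β) + k * (w / S)) * (x * D) - 2 * (α : ℂ) ^ 2 * ((α : ℂ) ^ 2 - Complex.I * β * w + k * S) * D = 2 * (α : ℂ) ^ 2 * D * (- k / S * ((α : ℂ) ^ 2 - Complex.I * β * w + k * S)) := by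
      rw [← h1]; ring
    rw [h2]
    field_simp
  have e0 : ((2 : ℕ) : ℂ) * w ^ (2 - 1) * 1 / (2 * S) = w / S := by
    norm_num
    field_simp
  rw [e0, eA, mul_one, one_mul, eL]
  field_simp
  rw [← hwx]
  linear_combination -hS2 + hk2C - (β : ℂ) ^ 2 * hI

theorem two_factor_nig_cumulant_formula
    (α₁ β₁ α₂ β₂ μ G Γ₂ y t T : ℝ)
    (hα₁ : 0 < α₁) (hβ₁ : |β₁| < α₁) (hα₂ : 0 < α₂) (hβ₂ : |β₂| < α₂)
    (hμ : 0 < μ) (hG : 0 < G) (hΓ₂ : 0 < Γ₂) (hy : 0 < y) (htT : t < T)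
    (c : ℝ → ℝ → ℂ)
    (hc : ∀ w u : ℝ, c w u = ((w * G * Real.exp (μ * u) : ℝ) : ℂ) - Complex.I * (β₁ : ℂ))
    (η : ℂ → ℂ)
    (hη : ∀ w : ℂ, η w = (1 / (μ : ℂ)) *
      (((α₁ : ℂ) ^ 2 + w ^ 2) ^ (1 / 2 : ℂ)
        - Complex.I * (β₁ : ℂ) *
            Complex.log (w / (α₁ : ℂ) + (1 + (w / (α₁ : ℂ)) ^ 2) ^ (1 / 2 : ℂ))
        - ((α₁ : ℂ) ^ 2 - (β₁ : ℂ) ^ 2) ^ (1 / 2 : ℂ) *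
            Complex.log (2 * (α₁ : ℂ) ^ 2 *
              ((α₁ : ℂ) ^ 2 - Complex.I * (β₁ : ℂ) * w
                + ((α₁ : ℂ) ^ 2 - (β₁ : ℂ) ^ 2) ^ (1 / 2 : ℂ) *
                  ((α₁ : ℂ) ^ 2 + w ^ 2) ^ (1 / 2 : ℂ)) /
              ((w + Complex.I * (β₁ : ℂ)) *
                ((((α₁ ^ 2 - β₁ ^ 2) ^ ((3 : ℝ) / 2) : ℝ)) : ℂ))))) :
    (∫ u in t..T,
        (((α₁ : ℂ) ^ 2 - (β₁ : ℂ) ^ 2) ^ (1 / 2 : ℂ)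
          - ((α₁ : ℂ) ^ 2
              - ((β₁ : ℂ) + Complex.I * (y : ℂ) * (G : ℂ) * (Real.exp (μ * u) : ℂ)) ^ 2)
            ^ (1 / 2 : ℂ)
          - Complex.I * (y : ℂ) * (G : ℂ) * (Real.exp (μ * u) : ℂ) * (β₁ : ℂ) /
              (((α₁ : ℂ) ^ 2 - (β₁ : ℂ) ^ 2) ^ (1 / 2 : ℂ))))
      + ((T : ℂ) - (t : ℂ)) *
        (((α₂ : ℂ) ^ 2 - (β₂ : ℂ) ^ 2) ^ (1 / 2 : ℂ)
          - ((α₂ : ℂ) ^ 2 - ((β₂ : ℂ) + Complex.I * (y : ℂ) * (Γ₂ : ℂ)) ^ 2) ^ (1 / 2 : ℂ)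
          - Complex.I * (y : ℂ) * (Γ₂ : ℂ) * (β₂ : ℂ) /
              (((α₂ : ℂ) ^ 2 - (β₂ : ℂ) ^ 2) ^ (1 / 2 : ℂ))) =
    ((T : ℂ) - (t : ℂ)) *
      (((α₁ : ℂ) ^ 2 - (β₁ : ℂ) ^ 2) ^ (1 / 2 : ℂ)
        + ((α₂ : ℂ) ^ 2 - (β₂ : ℂ) ^ 2) ^ (1 / 2 : ℂ)
        - Complex.I * (y : ℂ) *
            ((G : ℂ) * (β₁ : ℂ) * ((Real.exp (μ * T) : ℂ) - (Real.exp (μ * t) : ℂ)) /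
                ((μ : ℂ) * (((α₁ : ℂ) ^ 2 - (β₁ : ℂ) ^ 2) ^ (1 / 2 : ℂ)) * ((T : ℂ) - (t : ℂ)))
              + (Γ₂ : ℂ) * (β₂ : ℂ) / (((α₂ : ℂ) ^ 2 - (β₂ : ℂ) ^ 2) ^ (1 / 2 : ℂ)))
        - (η (c y T) - η (c y t)) / ((T : ℂ) - (t : ℂ))
        - ((α₂ : ℂ) ^ 2 - ((β₂ : ℂ) + Complex.I * (y : ℂ) * (Γ₂ : ℂ)) ^ 2) ^ (1 / 2 : ℂ)) := by
  have hβ2 : 0 < α₁ ^ 2 - β₁ ^ 2 := by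
    have := sq_lt_sq' (abs_lt.1 hβ₁).1 (abs_lt.1 hβ₁).2
    linarith
  obtain ⟨k, hk, hk2, hkC⟩ : ∃ k : ℝ, 0 < k ∧ k ^ 2 = α₁ ^ 2 - β₁ ^ 2 ∧
      ((α₁ : ℂ) ^ 2 - (β₁ : ℂ) ^ 2) ^ (1 / 2 : ℂ) = (k : ℂ) := by
    refine ⟨(α₁ ^ 2 - β₁ ^ 2) ^ (1 / 2 : ℝ), by positivity, ?_, ?_⟩
    · rw [← Real.sqrt_eq_rpow, Real.sq_sqrt hβ2.le]
    · rw [Complex.ofReal_cpow hβ2.le]; push_cast; rfl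
  have hD : 0 < (α₁ ^ 2 - β₁ ^ 2) ^ ((3 : ℝ) / 2) := by positivity
  generalize (α₁ ^ 2 - β₁ ^ 2) ^ ((3 : ℝ) / 2) = D at *
  rw [hkC] at *
  have hμC : (μ : ℂ) ≠ 0 := by exact_mod_cast hμ.ne'
  have hkC0 : (k : ℂ) ≠ 0 := by exact_mod_cast hk.ne'
  have hTt : (T : ℂ) - t ≠ 0 := by
    rw [sub_ne_zero]; exact_mod_cast htT.ne'
  have hη' : ∀ u : ℝ, HasDerivAt (fun u : ℝ => η (c y u))
      (((α₁ : ℂ) ^ 2 - ((β₁ : ℂ) + Complex.I * (y : ℂ) * (G : ℂ) * (Real.exp (μ * u) : ℂ)) ^ 2)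
            ^ (1 / 2 : ℂ)) u := by
    intro u
    have hx : 0 < y * G * Real.exp (μ * u) := by positivity
    have h1 := (eta_deriv α₁ β₁ k D _ hα₁ hk hD hx hk2 (c y u) (hc y u)).const_mul (1 / (μ : ℂ))
    have h2 : HasDerivAt η _ (c y u) := h1.congr_of_eventuallyEq (Filter.Eventually.of_forall hη)
    have hr : HasDerivAt (fun u : ℝ => y * G * Real.exp (μ * u))
        (y * G * (Real.exp (μ * u) * (μ * 1))) u :=
      (((hasDerivAt_id' u).const_mul μ).exp).const_mul (y * G)
    have h3 : HasDerivAt (c y) _ u :=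
      (hr.ofReal_comp.sub_const (Complex.I * (β₁ : ℂ))).congr_of_eventuallyEq
        (Filter.Eventually.of_forall (hc y))
    refine (h2.comp u h3).congr_deriv ?_
    have e : (α₁ : ℂ) ^ 2 - ((β₁ : ℂ) + Complex.I * (y : ℂ) * (G : ℂ) * (Real.exp (μ * u) : ℂ)) ^ 2
        = (α₁ : ℂ) ^ 2 + (c y u) ^ 2 := by
      rw [hc]; push_cast
      linear_combination (-(y * G * Complex.exp (μ * u)) ^ 2 - (β₁ : ℂ) ^ 2) * Complex.I_sq
    rw [e]
    have hy0 : (y : ℂ) ≠ 0 := by exact_mod_cast hy.ne'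
    have hG0 : (G : ℂ) ≠ 0 := by exact_mod_cast hG.ne'
    have he0 : Complex.exp ((μ : ℂ) * u) ≠ 0 := Complex.exp_ne_zero _
    push_cast
    field_simp
  have hE : ∀ u : ℝ, HasDerivAt (fun u : ℝ => (Real.exp (μ * u) : ℂ))
      ((Real.exp (μ * u) * (μ * 1) : ℝ) : ℂ) u := fun u =>
    (((hasDerivAt_id' u).const_mul μ).exp).ofReal_comp
  have hF : ∀ u : ℝ, HasDerivAt (fun u : ℝ => (k : ℂ) * (u : ℂ) - η (c y u)
        - Complex.I * y * G * β₁ / (k * μ) * (Real.exp (μ * u) : ℂ))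
      ((k : ℂ) - ((α₁ : ℂ) ^ 2
              - ((β₁ : ℂ) + Complex.I * (y : ℂ) * (G : ℂ) * (Real.exp (μ * u) : ℂ)) ^ 2)
            ^ (1 / 2 : ℂ)
          - Complex.I * (y : ℂ) * (G : ℂ) * (Real.exp (μ * u) : ℂ) * (β₁ : ℂ) / (k : ℂ)) u := by
    intro u
    refine (((((hasDerivAt_id' u).ofReal_comp).const_mul (k : ℂ)).sub (hη' u)).sub
      ((hE u).const_mul (Complex.I * y * G * β₁ / (k * μ)))).congr_deriv ?_
    push_cast
    field_simp
  rw [intervalIntegral.integral_eq_sub_of_hasDerivAt (fun u _ => hF u)]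
  · generalize ((α₂ : ℂ) ^ 2 - (β₂ : ℂ) ^ 2) ^ (1 / 2 : ℂ) = k₂
    generalize ((α₂ : ℂ) ^ 2 - ((β₂ : ℂ) + Complex.I * (y : ℂ) * (Γ₂ : ℂ)) ^ 2) ^ (1 / 2 : ℂ) = S₂
    simp only [div_eq_mul_inv, mul_inv]
    have h1 := mul_inv_cancel₀ hTt
    linear_combination (η (c y T) - η (c y t) + Complex.I * y * G * β₁ * ((Real.exp (μ * T) : ℂ) - (Real.exp (μ * t) : ℂ)) * (μ : ℂ)⁻¹ * (k : ℂ)⁻¹) * h1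
  · apply Continuous.intervalIntegrable
    refine Continuous.sub (Continuous.sub continuous_const ?_) (by fun_prop)
    refine Continuous.cpow (by fun_prop) continuous_const ?_
    intro u
    left
    have : ((α₁ : ℂ) ^ 2 - ((β₁ : ℂ) + Complex.I * (y : ℂ) * (G : ℂ) * (Real.exp (μ * u) : ℂ)) ^ 2).re
        = (α₁ ^ 2 - β₁ ^ 2) + (y * G * Real.exp (μ * u)) ^ 2 := by
      generalize Real.exp (μ * u) = e
      simp [pow_two]; ring
    rw [this]; positivity
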